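/- Let v_RF be the supremum of val(x) over all reroutable s-t-flows x, let v_SRF be the supremum of val(x) over all strictly reroutable s-t-flows x, and let c be the infimum of cap(R,C) over all R-cuts (R,C). If v_SRF > 0, then min{ c / v_RF , v_RF / v_SRF } ≤ √2; equivalently, c ≤ 2·v_SRF, so the flow/cut gap and the gap between reroutable and strictly reroutable flows cannot both exceed √2. -/

import Mathlib

open scoped BigOperators

variable {V A : Type}

/-- `IsWalk tl hd v w L`: the list of arcs `L` forms a walk from `v` to `w`
in the digraph whose arcs `a` go from `tl a` to `hd a`. -/
def IsWalk (tl hd : A → V) : V → V → List A → Prop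
  | v, w, [] => v = w
  | v, w, a :: L => tl a = v ∧ IsWalk tl hd (hd a) w L

/-- A simple path from `v` to `w`: a walk visiting no vertex twice. -/
def IsPath (tl hd : A → V) (v w : V) (L : List A) : Prop :=
  IsWalk tl hd v w L ∧ (v :: L.map hd).Nodup

/-- `Before L b a`: the list `L` traverses `b` (strictly) before `a`. -/
def Before (L : List A) (b a : A) : Prop :=
  ∃ l₁ l₂ l₃ : List A, L = l₁ ++ b :: (l₂ ++ a :: l₃)

/-- Sum of a path-flow over a set of paths. -/
noncomputable def sumOver (x : List A → ℝ) (S : Set (List A)) : ℝ :=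
  ∑ᶠ P ∈ S, x P

/-- Flow value `x(a)` on an arc `a`: total flow on `s`-`t`-paths through `a`. -/
noncomputable def arcFlow (tl hd : A → V) (s t : V) (x : List A → ℝ) (a : A) : ℝ :=
  sumOver x {P | IsPath tl hd s t P ∧ a ∈ P}

/-- The value of a flow: total flow on all `s`-`t`-paths. -/
noncomputable def flowVal (tl hd : A → V) (s t : V) (x : List A → ℝ) : ℝ :=
  sumOver x {P | IsPath tl hd s t P}

/-- An `s`-`t`-(path-)flow: nonnegative, supported on simple `s`-`t`-paths,
respecting the arc capacities `u`. -/
def IsFlow (tl hd : A → V) (s t : V) (u : A → ℝ) (x : List A → ℝ) : Prop :=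
  (∀ P, 0 ≤ x P) ∧ (∀ P, ¬ IsPath tl hd s t P → x P = 0) ∧
    ∀ a : A, arcFlow tl hd s t x a ≤ u a

/-- Available capacity `ū_{x,b}(a)` of arc `a` after failure of arc `b`:
`u(a)` minus the flow on paths through `a` that do not traverse `b` before `a`. -/
noncomputable def availCap (tl hd : A → V) (s t : V) (u : A → ℝ) (x : List A → ℝ)
    (b a : A) : ℝ :=
  u a - sumOver x {P | IsPath tl hd s t P ∧ a ∈ P ∧ ¬ Before P b a}

/-- Arc flow of a rerouting flow `y` for failing arc `b`: `y` lives on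
`tl b`-`t`-paths avoiding `b`. -/
noncomputable def reArcFlow (tl hd : A → V) (t : V) (b : A) (y : List A → ℝ) (a : A) : ℝ :=
  sumOver y {Q | IsPath tl hd (tl b) t Q ∧ b ∉ Q ∧ a ∈ Q}

/-- Value of a rerouting flow `y` for failing arc `b`. -/
noncomputable def reVal (tl hd : A → V) (t : V) (b : A) (y : List A → ℝ) : ℝ :=
  sumOver y {Q | IsPath tl hd (tl b) t Q ∧ b ∉ Q}

/-- `y` is a rerouting of `x` for the failing arc `b`: a `tl b`-`t`-flow of value
`x(b)` in `(V, A ∖ {b})` with capacities `ū_{x,b}`. -/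
def IsRerouting (tl hd : A → V) (s t : V) (u : A → ℝ) (x : List A → ℝ) (b : A)
    (y : List A → ℝ) : Prop :=
  (∀ Q, 0 ≤ y Q) ∧
  (∀ Q, ¬ (IsPath tl hd (tl b) t Q ∧ b ∉ Q) → y Q = 0) ∧
  (∀ a : A, a ≠ b → reArcFlow tl hd t b y a ≤ availCap tl hd s t u x b a) ∧
  reVal tl hd t b y = arcFlow tl hd s t x b

/-- `y` is a strict rerouting of `x` for the failing arc `b`: a `tl b`-`t`-flow
of value `x(b)` in `(V, A ∖ {b})` with `y(a) ≤ u(a) - x(a)` for all `a ≠ b`. -/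
def IsStrictRerouting (tl hd : A → V) (s t : V) (u : A → ℝ) (x : List A → ℝ) (b : A)
    (y : List A → ℝ) : Prop :=
  (∀ Q, 0 ≤ y Q) ∧
  (∀ Q, ¬ (IsPath tl hd (tl b) t Q ∧ b ∉ Q) → y Q = 0) ∧
  (∀ a : A, a ≠ b → reArcFlow tl hd t b y a ≤ u a - arcFlow tl hd s t x a) ∧
  reVal tl hd t b y = arcFlow tl hd s t x b

/-- `x` is reroutable: a rerouting exists for every failing arc. -/
def Reroutable (tl hd : A → V) (s t : V) (u : A → ℝ) (x : List A → ℝ) : Prop :=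
  ∀ b : A, ∃ y : List A → ℝ, IsRerouting tl hd s t u x b y

/-- `x` is strictly reroutable: a strict rerouting exists for every failing arc. -/
def StrictlyReroutable (tl hd : A → V) (s t : V) (u : A → ℝ) (x : List A → ℝ) : Prop :=
  ∀ b : A, ∃ y : List A → ℝ, IsStrictRerouting tl hd s t u x b y

/-- A `v`-`w`-cut: a (finite) set of arcs meeting every simple `v`-`w`-path. -/
def IsCut (tl hd : A → V) (v w : V) (C : Finset A) : Prop :=
  ∀ L : List A, IsPath tl hd v w L → ∃ a ∈ C, a ∈ L

/-- A `v`-`w`-cut in the digraph obtained by deleting the arcs in `Del`. -/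
def IsCutIn (tl hd : A → V) (v w : V) (Del : Finset A) (S : Finset A) : Prop :=
  Disjoint S Del ∧
    ∀ L : List A, IsPath tl hd v w L → (∀ a ∈ L, a ∉ Del) → ∃ a ∈ S, a ∈ L

/-- Minimum capacity of a `v`-`w`-cut in the digraph with the arcs of `Del` deleted. -/
noncomputable def minCutCap (tl hd : A → V) (v w : V) (u : A → ℝ) (Del : Finset A) : ℝ :=
  sInf {c : ℝ | ∃ S : Finset A, IsCutIn tl hd v w Del S ∧ c = ∑ a ∈ S, u a}

/-- An R-cut: a set `R` of arcs with, for each `a ∈ R`, a `tl a`-`t`-cut `C a` containing `a`. -/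
def IsRCut (tl hd : A → V) (t : V) (R : Finset A) (C : A → Finset A) : Prop :=
  ∀ a ∈ R, a ∈ C a ∧ IsCut tl hd (tl a) t (C a)

/-- Capacity of an R-cut: `φ(R,C) + ∑_{a ∈ R} u(C_a ∖ {a})`, where `φ(R,C)` is the
minimum capacity of an `s`-`t`-cut after deleting all arcs of `⋃_{a ∈ R} C_a`. -/
noncomputable def rcutCap [DecidableEq A] (tl hd : A → V) (s t : V) (u : A → ℝ)
    (R : Finset A) (C : A → Finset A) : ℝ :=
  minCutCap tl hd s t u (R.biUnion C) + ∑ a ∈ R, ∑ a' ∈ (C a).erase a, u a'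

theorem farkas_bartl {W ι : Type} [AddCommGroup W] [Module ℝ W] (S : Finset ι) :
    ∀ (f : ι → W →ₗ[ℝ] ℝ) (g : W →ₗ[ℝ] ℝ),
      (∀ x, (∀ i ∈ S, f i x ≤ 0) → g x ≤ 0) →
      ∃ l : ι → ℝ, (∀ i, 0 ≤ l i) ∧ ∀ x, g x = ∑ i ∈ S, l i * f i x := by
  classical
  induction S using Finset.induction_on with
  | empty =>
    intro f g h
    refine ⟨fun _ => 0, fun _ => le_rfl, fun x => ?_⟩
    have h1 := h x (by simp)
    have h2 := h (-x) (by simp)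
    rw [map_neg] at h2
    simp
    linarith
  | insert j S hj ih =>
    intro f g h
    by_cases hg : ∀ x, (∀ i ∈ S, f i x ≤ 0) → g x ≤ 0
    · obtain ⟨l, hl, hx⟩ := ih f g hg
      refine ⟨fun i => if i = j then 0 else l i, fun i => ?_, fun x => ?_⟩
      · dsimp only
        split_ifs
        · exact le_rfl
        · exact hl i
      · rw [Finset.sum_insert hj, hx x]
        simp only [if_true, zero_mul, zero_add]
        refine Finset.sum_congr rfl fun i hi => ?_
        have hij : i ≠ j := by
          rintro rfl
          exact hj hi
        rw [if_neg hij]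
    · push Not at hg
      obtain ⟨x1, hx1, hgx1⟩ := hg
      have hfj : 0 < f j x1 := by
        by_contra hc
        have := h x1 (by
          intro i hi
          rcases Finset.mem_insert.1 hi with rfl | hi
          · linarith
          · exact hx1 i hi)
        linarith
      obtain ⟨x0, hx0, hgx0, hj0⟩ : ∃ x0, (∀ i ∈ S, f i x0 ≤ 0) ∧ 0 < g x0 ∧ f j x0 = 1 := by
        refine ⟨(f j x1)⁻¹ • x1, fun i hi => ?_, ?_, ?_⟩
        · rw [map_smul, smul_eq_mul]
          exact mul_nonpos_of_nonneg_of_nonpos (inv_nonneg.2 hfj.le) (hx1 i hi)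
        · rw [map_smul, smul_eq_mul]
          positivity
        · rw [map_smul, smul_eq_mul]
          exact inv_mul_cancel₀ hfj.ne'
      obtain ⟨l, hl, hx⟩ := ih (fun i => f i - (f i x0) • f j) (g - (g x0) • f j) (by
        intro x hx
        have := h (x - (f j x) • x0) (by
          intro i hi
          rcases Finset.mem_insert.1 hi with rfl | hi
          · simp [hj0]
          · have := hx i hi
            simp at this ⊢
            linarith)
        simp at this ⊢
        linarith)
      have hnp : ∑ i ∈ S, l i * f i x0 ≤ 0 :=
        Finset.sum_nonpos fun i hi => mul_nonpos_of_nonneg_of_nonpos (hl i) (hx0 i hi)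
      refine ⟨fun i => if i = j then g x0 - ∑ i ∈ S, l i * f i x0 else l i, fun i => ?_, fun x => ?_⟩
      · dsimp only
        split_ifs
        · linarith
        · exact hl i
      · rw [Finset.sum_insert hj]
        have h1 : ∑ i ∈ S, (if i = j then g x0 - ∑ i ∈ S, l i * f i x0 else l i) * f i x
            = ∑ i ∈ S, l i * f i x := by
          refine Finset.sum_congr rfl fun i hi => ?_
          have hij : i ≠ j := by
            rintro rfl
            exact hj hi
          rw [if_neg hij]
        simp only [if_true]
        rw [h1]
        have h2 := hx x
        simp only [LinearMap.sub_apply, LinearMap.smul_apply, smul_eq_mul, mul_sub,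
          Finset.sum_sub_distrib] at h2
        have h3 : ∑ i ∈ S, l i * (f i x0 * f j x) = (∑ i ∈ S, l i * f i x0) * f j x := by
          rw [Finset.sum_mul]
          exact Finset.sum_congr rfl fun i _ => by ring
        rw [h3] at h2
        linarith

theorem farkas_nonneg {W ι κ : Type} [AddCommGroup W] [Module ℝ W] [Fintype ι] (K : Finset κ)
    (f : ι → W →ₗ[ℝ] ℝ) (e : κ → W →ₗ[ℝ] ℝ) (g : W →ₗ[ℝ] ℝ)
    (h : ∀ x, (∀ k ∈ K, 0 ≤ e k x) → (∀ i, f i x ≤ 0) → g x ≤ 0) :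
    ∃ l : ι → ℝ, (∀ i, 0 ≤ l i) ∧
      ∀ x, (∀ k ∈ K, 0 ≤ e k x) → g x ≤ ∑ i, l i * f i x := by
  classical
  obtain ⟨l, hl, hx⟩ := farkas_bartl (Finset.disjSum (Finset.univ : Finset ι) K)
    (Sum.elim f (fun k => - e k)) g (by
      intro x hx
      refine h x (fun k hk => ?_) (fun i => ?_)
      · have := hx (Sum.inr k) (by simpa using hk)
        simpa using this
      · have := hx (Sum.inl i) (by simp)
        simpa using this)
  refine ⟨fun i => l (Sum.inl i), fun i => hl _, fun x hxe => ?_⟩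
  rw [hx x, Finset.sum_disjSum]
  have : ∑ k ∈ K, l (Sum.inr k) * (Sum.elim f (fun k => - e k) (Sum.inr k)) x ≤ 0 :=
    Finset.sum_nonpos fun k hk => mul_nonpos_of_nonneg_of_nonpos (hl _) (by
      simpa using hxe k hk)
  simpa using this

theorem exists_threshold {ι : Type} [Fintype ι] (c p l : ι → ℝ) (hc : ∀ i, 0 ≤ c i)
    (hl : ∀ i, 0 ≤ l i) :
    ∃ θ : ℝ, 0 ≤ θ ∧ θ < 1 ∧
      ∑ i, c i * (Set.Ico (p i) (p i + l i)).indicator (fun _ => (1:ℝ)) θ ≤ ∑ i, c i * l i := by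
  classical
  have hint : ∀ i, MeasureTheory.Integrable
      ((Set.Ico (p i) (p i + l i)).indicator (fun _ => (1:ℝ))) := by
    intro i
    rw [MeasureTheory.integrable_indicator_iff measurableSet_Ico]
    exact MeasureTheory.integrableOn_const (by simp)
  have hval : ∀ i, ∫ θ, (Set.Ico (p i) (p i + l i)).indicator (fun _ => (1:ℝ)) θ = l i := by
    intro i
    rw [MeasureTheory.integral_indicator measurableSet_Ico]
    simp [hl i]
  obtain ⟨θ, hθ, h⟩ := MeasureTheory.exists_le_setAverage (μ := MeasureTheory.volume)
    (s := Set.Ico (0:ℝ) 1)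
    (f := fun θ => ∑ i, c i * (Set.Ico (p i) (p i + l i)).indicator (fun _ => (1:ℝ)) θ)
    (by simp) (by simp)
    (MeasureTheory.integrable_finsetSum _ fun i _ => ((hint i).const_mul _).integrableOn)
  refine ⟨θ, hθ.1, hθ.2, h.trans ?_⟩
  rw [MeasureTheory.setAverage_eq]
  simp only [MeasureTheory.measureReal_def, Real.volume_Ico, sub_zero, ENNReal.ofReal_one,
    ENNReal.toReal_one, inv_one, one_smul]
  refine (MeasureTheory.setIntegral_le_integral
    (MeasureTheory.integrable_finsetSum _ fun i _ => ((hint i).const_mul _)) ?_).trans ?_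
  · refine Filter.Eventually.of_forall fun θ => ?_
    exact Finset.sum_nonneg fun i _ => mul_nonneg (hc i)
      (Set.indicator_nonneg (fun _ _ => zero_le_one) _)
  · rw [MeasureTheory.integral_finsetSum _ fun i _ => ((hint i).const_mul _)]
    refine Finset.sum_le_sum fun i _ => ?_
    rw [MeasureTheory.integral_const_mul, hval]

theorem path_suffix (tl hd : A → V) (w v : V) : ∀ (L : List A) (x : V), IsPath tl hd x w L →
    v ∈ x :: L.map hd → ∃ L', IsPath tl hd v w L' ∧ L'.Sublist L := by
  intro L
  induction L with
  | nil =>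
    intro x h hv
    simp at hv
    subst hv
    exact ⟨[], h, List.Sublist.refl _⟩
  | cons a L ih =>
    intro x h hv
    rcases List.mem_cons.1 hv with rfl | hv
    · exact ⟨a :: L, h, List.Sublist.refl _⟩
    · obtain ⟨L', h1, h2⟩ := ih (hd a) ⟨h.1.2, (List.nodup_cons.1 h.2).2⟩ hv
      exact ⟨L', h1, h2.trans (List.sublist_cons_self _ _)⟩

theorem walk_to_path (tl hd : A → V) (w : V) : ∀ (L : List A) (v : V), IsWalk tl hd v w L →
    ∃ L', IsPath tl hd v w L' ∧ L'.Sublist L := by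
  classical
  intro L
  induction L with
  | nil =>
    intro v h
    exact ⟨[], ⟨h, by simp⟩, List.Sublist.refl _⟩
  | cons a L ih =>
    intro v h
    obtain ⟨L', h1, h2⟩ := ih (hd a) h.2
    by_cases hv : v ∈ hd a :: L'.map hd
    · obtain ⟨L2, h3, h4⟩ := path_suffix tl hd w v L' (hd a) h1 hv
      exact ⟨L2, h3, (h4.trans h2).trans (List.sublist_cons_self _ _)⟩
    · exact ⟨a :: L', ⟨⟨h.1, h1.1⟩, List.nodup_cons.2 ⟨hv, h1.2⟩⟩, h2.cons_cons _⟩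

theorem walk_concat (tl hd : A → V) (e : A) : ∀ (L : List A) (v : V), IsWalk tl hd v (tl e) L →
    IsWalk tl hd v (hd e) (L ++ [e]) := by
  intro L
  induction L with
  | nil =>
    intro v h
    exact ⟨h.symm, rfl⟩
  | cons a L ih =>
    intro v h
    exact ⟨h.1, ih _ h.2⟩

theorem exists_potential (tl hd : A → V) (p t : V) (ok : A → Prop) (ell : A → ℝ)
    (hell : ∀ a, 0 ≤ ell a) (K : ℝ) (hK : 0 ≤ K)
    (h : ∀ Q, IsPath tl hd p t Q → (∀ a ∈ Q, ok a) → K ≤ (Q.map ell).sum) :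
    ∃ d : V → ℝ, d p ≤ 0 ∧ K ≤ d t ∧ ∀ e, ok e → d (hd e) ≤ d (tl e) + ell e := by
  let T : V → Set ℝ := fun v =>
    insert K {r | ∃ L, IsWalk tl hd p v L ∧ (∀ a ∈ L, ok a) ∧ r = (L.map ell).sum}
  have hpos : ∀ L : List A, 0 ≤ (L.map ell).sum := fun L =>
    List.sum_nonneg (by
      intro x hx
      obtain ⟨a, _, rfl⟩ := List.mem_map.1 hx
      exact hell a)
  have hbdd : ∀ v, BddBelow (T v) := by
    intro v
    refine ⟨0, ?_⟩
    rintro r (rfl | ⟨L, _, _, rfl⟩)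
    · exact hK
    · exact hpos L
  have hne : ∀ v, (T v).Nonempty := fun v => ⟨K, Set.mem_insert _ _⟩
  refine ⟨fun v => sInf (T v), ?_, ?_, ?_⟩
  · exact csInf_le (hbdd p) (Or.inr ⟨[], rfl, by simp, by simp⟩)
  · refine le_csInf (hne t) ?_
    rintro r (rfl | ⟨L, hL, hok, rfl⟩)
    · exact le_rfl
    · obtain ⟨L', h1, h2⟩ := walk_to_path tl hd t L p hL
      refine (h L' h1 fun a ha => hok a (h2.subset ha)).trans ?_
      refine (h2.map ell).sum_le_sum ?_
      intro x hx
      obtain ⟨a, _, rfl⟩ := List.mem_map.1 hx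
      exact hell a
  · intro e he
    rw [← sub_le_iff_le_add]
    refine le_csInf (hne _) ?_
    rintro r (rfl | ⟨L, hL, hok, rfl⟩)
    · have := csInf_le (hbdd (hd e)) (Set.mem_insert r _)
      have := hell e
      linarith
    · rw [sub_le_iff_le_add]
      refine csInf_le (hbdd (hd e)) (Or.inr ⟨L ++ [e], walk_concat tl hd e L p hL, ?_, by simp⟩)
      intro a ha
      rcases List.mem_append.1 ha with ha | ha
      · exact hok a ha
      · simp at ha
        exact ha ▸ he

theorem exists_crossing (tl hd : A → V) (t : V) (d : V → ℝ) (θ : ℝ) (ht : θ < d t) :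
    ∀ (L : List A) (v : V), IsWalk tl hd v t L → d v ≤ θ →
      ∃ e ∈ L, d (tl e) ≤ θ ∧ θ < d (hd e) := by
  intro L
  induction L with
  | nil =>
    intro v h hv
    have h : v = t := h
    subst h
    linarith
  | cons a L ih =>
    intro v h hv
    by_cases h1 : d (hd a) ≤ θ
    · obtain ⟨e, he, h2⟩ := ih _ h.2 h1
      exact ⟨e, List.mem_cons_of_mem _ he, h2⟩
    · exact ⟨a, List.mem_cons_self, by rw [h.1]; exact hv, not_le.1 h1⟩

theorem IsPath.nodup {tl hd : A → V} {v w : V} {L : List A} (h : IsPath tl hd v w L) : L.Nodup :=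
  List.Nodup.of_map hd (List.nodup_cons.1 h.2).2

theorem paths_finite [Fintype A] (tl hd : A → V) (v w : V) : {L | IsPath tl hd v w L}.Finite := by
  classical
  refine Set.Finite.subset (s := {l : List A | l.Nodup}) ?_ fun L h => IsPath.nodup h
  exact Set.finite_coe_iff.1 (inferInstanceAs (Finite {l : List A // l.Nodup}))

theorem sumOver_eq (x : List A → ℝ) (S : Set (List A)) (T : Finset (List A))
    (h : ∀ P, P ∈ T ↔ P ∈ S) : sumOver x S = ∑ P ∈ T, x P := by
  have : S = (T : Set (List A)) := by
    ext P
    simp [h P]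
  rw [sumOver, this, finsum_mem_coe_finset]

noncomputable def PS [Fintype A] (tl hd : A → V) (v w : V) : Finset (List A) :=
  (paths_finite tl hd v w).toFinset

noncomputable def QS [Fintype A] [DecidableEq A] (tl hd : A → V) (t : V) (b : A) :
    Finset (List A) :=
  (PS tl hd (tl b) t).filter (fun Q => b ∉ Q)

theorem mem_PS [Fintype A] (tl hd : A → V) (v w : V) (P : List A) :
    P ∈ PS tl hd v w ↔ IsPath tl hd v w P := by
  simp [PS]

theorem mem_QS [Fintype A] [DecidableEq A] (tl hd : A → V) (t : V) (b : A) (P : List A) :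
    P ∈ QS tl hd t b ↔ IsPath tl hd (tl b) t P ∧ b ∉ P := by
  simp [QS, mem_PS]

theorem val_le [Fintype A] [DecidableEq A] (T : Finset (List A)) (x : List A → ℝ)
    (hx : ∀ P ∈ T, 0 ≤ x P) (hT : ∀ P ∈ T, P ≠ []) :
    ∑ P ∈ T, x P ≤ ∑ a : A, ∑ P ∈ T.filter (fun P => a ∈ P), x P := by
  simp only [Finset.sum_filter]
  rw [Finset.sum_comm]
  refine Finset.sum_le_sum fun P hP => ?_
  obtain ⟨a, ha⟩ := List.exists_mem_of_ne_nil P (hT P hP)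
  have := Finset.single_le_sum (f := fun a => if a ∈ P then x P else 0) (s := Finset.univ)
    (fun a _ => by
      split_ifs
      · exact hx P hP
      · exact le_rfl) (Finset.mem_univ a)
  simpa [ha] using this

theorem path_ne_nil {tl hd : A → V} {s t : V} (hst : s ≠ t) {P : List A}
    (h : IsPath tl hd s t P) : P ≠ [] := by
  rintro rfl
  exact hst h.1

theorem raw_le [Fintype A] [DecidableEq A] (tl hd : A → V) (s t : V) (hst : s ≠ t)
    (u : A → ℝ) (x : List A → ℝ) (y : A → List A → ℝ)
    (hx : ∀ P ∈ PS tl hd s t, 0 ≤ x P) (hy : ∀ b, ∀ Q ∈ QS tl hd t b, 0 ≤ y b Q)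
    (h3 : ∀ a, ∑ P ∈ (PS tl hd s t).filter (fun P => a ∈ P), x P ≤ u a)
    (h4 : ∀ b a, a ≠ b → ∑ Q ∈ (QS tl hd t b).filter (fun Q => a ∈ Q), y b Q
      + ∑ P ∈ (PS tl hd s t).filter (fun P => a ∈ P), x P ≤ u a)
    (h5 : ∀ b, ∑ P ∈ (PS tl hd s t).filter (fun P => b ∈ P), x P ≤ ∑ Q ∈ QS tl hd t b, y b Q) :
    ∑ P ∈ PS tl hd s t, x P ≤ sSup {r : ℝ | ∃ x : List A → ℝ,
      IsFlow tl hd s t u x ∧ StrictlyReroutable tl hd s t u x ∧ r = flowVal tl hd s t x} := by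
  classical
  have harc : ∀ (z : List A → ℝ) a, arcFlow tl hd s t z a =
      ∑ P ∈ (PS tl hd s t).filter (fun P => a ∈ P), z P := fun z a =>
    sumOver_eq _ _ _ (by simp [mem_PS])
  have hval : ∀ (z : List A → ℝ), flowVal tl hd s t z = ∑ P ∈ PS tl hd s t, z P := fun z =>
    sumOver_eq _ _ _ (by simp [mem_PS])
  have hre : ∀ (z : List A → ℝ) b a, reArcFlow tl hd t b z a =
      ∑ Q ∈ (QS tl hd t b).filter (fun P => a ∈ P), z Q := fun z b a =>
    sumOver_eq _ _ _ (by simp [mem_QS, and_assoc])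
  have hrev : ∀ (z : List A → ℝ) b, reVal tl hd t b z =
      ∑ Q ∈ QS tl hd t b, z Q := fun z b =>
    sumOver_eq _ _ _ (by simp [mem_QS])
  refine le_csSup ?_ ?_
  · refine ⟨∑ a, u a, ?_⟩
    rintro r ⟨z, hz, -, rfl⟩
    rw [hval]
    refine (val_le _ z (fun P _ => hz.1 P)
      (fun P hP => path_ne_nil hst ((mem_PS _ _ _ _ _).1 hP))).trans ?_
    refine Finset.sum_le_sum fun a _ => ?_
    rw [← harc]
    exact hz.2.2 a
  · let x' : List A → ℝ := fun P => if P ∈ PS tl hd s t then x P else 0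
    have hx' : ∀ P ∈ PS tl hd s t, x' P = x P := fun P hP => if_pos hP
    have hax : ∀ a, arcFlow tl hd s t x' a =
      ∑ P ∈ (PS tl hd s t).filter (fun P => a ∈ P), x P := fun a => by
        rw [harc]
        exact Finset.sum_congr rfl fun P hP => hx' P (Finset.mem_filter.1 hP).1
    refine ⟨x', ⟨fun P => ?_, fun P hP => ?_, fun a => ?_⟩, fun b => ?_, ?_⟩
    · dsimp only [x']
      split_ifs with h
      · exact hx P h
      · exact le_rfl
    · exact if_neg fun h => hP ((mem_PS _ _ _ _ _).1 h)
    · rw [hax]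
      exact h3 a
    · set X := ∑ P ∈ (PS tl hd s t).filter (fun P => b ∈ P), x P with hX
      set Y := ∑ Q ∈ QS tl hd t b, y b Q with hY
      have hX0 : 0 ≤ X := Finset.sum_nonneg fun P hP => hx P (Finset.mem_filter.1 hP).1
      have hXY : X ≤ Y := h5 b
      have hr0 : 0 ≤ X / Y := div_nonneg hX0 (hX0.trans hXY)
      have hr1 : X / Y ≤ 1 := div_le_one_of_le₀ hXY (hX0.trans hXY)
      let y' : List A → ℝ := fun Q => if Q ∈ QS tl hd t b then y b Q * (X / Y) else 0
      have hy' : ∀ Q ∈ QS tl hd t b, y' Q = y b Q * (X / Y) := fun Q hQ => if_pos hQ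
      refine ⟨y', fun Q => ?_, fun Q hQ => ?_, fun a hab => ?_, ?_⟩
      · dsimp only [y']
        split_ifs with h
        · exact mul_nonneg (hy b Q h) hr0
        · exact le_rfl
      · exact if_neg fun h => hQ ((mem_QS _ _ _ _ _).1 h)
      · rw [hre, hax]
        have h1 : ∑ Q ∈ (QS tl hd t b).filter (fun P => a ∈ P), y' Q ≤
            ∑ Q ∈ (QS tl hd t b).filter (fun P => a ∈ P), y b Q := by
          refine Finset.sum_le_sum fun Q hQ => ?_
          have hQ := (Finset.mem_filter.1 hQ).1
          rw [hy' Q hQ]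
          exact mul_le_of_le_one_right (hy b Q hQ) hr1
        have h2 := h4 b a hab
        linarith
      · rw [hrev, hax, Finset.sum_congr rfl hy', ← Finset.sum_mul, ← hY, ← hX]
        by_cases hY0 : Y = 0
        · have : X = 0 := le_antisymm (hY0 ▸ hXY) hX0
          rw [this, hY0]
          simp
        · field_simp
    · rw [hval]
      exact (Finset.sum_congr rfl hx').symm

theorem raw_scaled [Fintype A] [DecidableEq A] (tl hd : A → V) (s t : V) (hst : s ≠ t)
    (u : A → ℝ) (x : List A → ℝ) (y : A → List A → ℝ) (τ : ℝ) (hτ : 0 ≤ τ)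
    (hx : ∀ P ∈ PS tl hd s t, 0 ≤ x P) (hy : ∀ b, ∀ Q ∈ QS tl hd t b, 0 ≤ y b Q)
    (h3 : ∀ a, ∑ P ∈ (PS tl hd s t).filter (fun P => a ∈ P), x P ≤ u a * τ)
    (h4 : ∀ b a, a ≠ b → ∑ Q ∈ (QS tl hd t b).filter (fun Q => a ∈ Q), y b Q
      + ∑ P ∈ (PS tl hd s t).filter (fun P => a ∈ P), x P ≤ u a * τ)
    (h5 : ∀ b, ∑ P ∈ (PS tl hd s t).filter (fun P => b ∈ P), x P ≤ ∑ Q ∈ QS tl hd t b, y b Q) :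
    ∑ P ∈ PS tl hd s t, x P ≤ sSup {r : ℝ | ∃ x : List A → ℝ,
      IsFlow tl hd s t u x ∧ StrictlyReroutable tl hd s t u x ∧ r = flowVal tl hd s t x} * τ := by
  rcases hτ.eq_or_lt with rfl | hpos
  · rw [mul_zero]
    refine (val_le _ x hx (fun P hP => path_ne_nil hst ((mem_PS _ _ _ _ _).1 hP))).trans ?_
    refine Finset.sum_nonpos fun a _ => ?_
    simpa using h3 a
  · rw [← div_le_iff₀ hpos, Finset.sum_div]
    refine raw_le tl hd s t hst u (fun P => x P / τ) (fun b Q => y b Q / τ) ?_ ?_ ?_ ?_ ?_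
    · exact fun P hP => div_nonneg (hx P hP) hτ
    · exact fun b Q hQ => div_nonneg (hy b Q hQ) hτ
    · intro a
      rw [← Finset.sum_div, div_le_iff₀ hpos]
      exact h3 a
    · intro b a hab
      rw [← Finset.sum_div, ← Finset.sum_div, ← add_div, div_le_iff₀ hpos]
      exact h4 b a hab
    · intro b
      rw [← Finset.sum_div, ← Finset.sum_div]
      exact div_le_div_of_nonneg_right (h5 b) hτ

theorem lp_dual [Fintype A] [DecidableEq A] (tl hd : A → V) (s t : V) (hst : s ≠ t)
    (u : A → ℝ) (v : ℝ) (hv : v = sSup {r : ℝ | ∃ x : List A → ℝ,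
      IsFlow tl hd s t u x ∧ StrictlyReroutable tl hd s t u x ∧ r = flowVal tl hd s t x}) :
    ∃ (y p : A → ℝ) (w : A → A → ℝ), (∀ a, 0 ≤ y a) ∧ (∀ a, 0 ≤ p a) ∧ (∀ b a, 0 ≤ w b a) ∧
      (∀ b, w b b = 0) ∧
      (∀ P, IsPath tl hd s t P → 1 ≤ (P.map fun a => y a + ∑ b, w b a + p a).sum) ∧
      (∀ b Q, IsPath tl hd (tl b) t Q → b ∉ Q → p b ≤ (Q.map fun a => w b a).sum) ∧
      ∑ a, u a * y a + ∑ b, ∑ a, u a * w b a ≤ v := by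
  classical
  let W := (List A → ℝ) × (A → List A → ℝ) × ℝ
  let X : List A → W →ₗ[ℝ] ℝ := fun P => LinearMap.proj P ∘ₗ LinearMap.fst ℝ _ _
  let Y : A → List A → W →ₗ[ℝ] ℝ := fun b Q =>
    LinearMap.proj Q ∘ₗ LinearMap.proj b ∘ₗ LinearMap.fst ℝ _ _ ∘ₗ LinearMap.snd ℝ _ _
  let T : W →ₗ[ℝ] ℝ := LinearMap.snd ℝ _ _ ∘ₗ LinearMap.snd ℝ _ _
  let XA : A → W →ₗ[ℝ] ℝ := fun a => ∑ P ∈ (PS tl hd s t).filter (fun P => a ∈ P), X P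
  let YA : A → A → W →ₗ[ℝ] ℝ := fun b a => ∑ Q ∈ (QS tl hd t b).filter (fun Q => a ∈ Q), Y b Q
  let f : A ⊕ (A × A) ⊕ A → W →ₗ[ℝ] ℝ := Sum.elim (fun a => XA a - u a • T)
    (Sum.elim (fun q => if q.1 = q.2 then 0 else YA q.1 q.2 + XA q.2 - u q.2 • T)
      (fun b => XA b - ∑ Q ∈ QS tl hd t b, Y b Q))
  let g : W →ₗ[ℝ] ℝ := ∑ P ∈ PS tl hd s t, X P - v • T
  let K : Finset (W →ₗ[ℝ] ℝ) := (PS tl hd s t).image X ∪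
    (Finset.univ.biUnion fun b => (QS tl hd t b).image (Y b)) ∪ {T}
  have hX : ∀ z P, X P z = z.1 P := fun z P => rfl
  have hY : ∀ z b P, Y b P z = z.2.1 b P := fun z b P => rfl
  have hT : ∀ z, T z = z.2.2 := fun z => rfl
  have hXA : ∀ z a, XA a z = ∑ P ∈ (PS tl hd s t).filter (fun P => a ∈ P), z.1 P := fun z a => by
    simp only [XA, LinearMap.sum_apply, hX]
  have hYA : ∀ z b a, YA b a z = ∑ P ∈ (QS tl hd t b).filter (fun P => a ∈ P), z.2.1 b P :=
    fun z b a => by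
      simp only [YA, LinearMap.sum_apply, hY]
  have hg : ∀ z, g z = ∑ P ∈ PS tl hd s t, z.1 P - v * z.2.2 := fun z => by
    simp only [g, LinearMap.sub_apply, LinearMap.smul_apply, LinearMap.sum_apply, hX, hT,
      smul_eq_mul]
  have hK : ∀ z, (∀ k ∈ K, 0 ≤ (id k : W →ₗ[ℝ] ℝ) z) ↔ (∀ P ∈ PS tl hd s t, 0 ≤ z.1 P) ∧
      (∀ b, ∀ Q ∈ QS tl hd t b, 0 ≤ z.2.1 b Q) ∧ 0 ≤ z.2.2 := by
    intro z
    constructor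
    · intro h
      refine ⟨fun P hP => h (X P) ?_, fun b Q hQ => h (Y b Q) ?_, h T ?_⟩
      · exact Finset.mem_union_left _ (Finset.mem_union_left _ (Finset.mem_image_of_mem _ hP))
      · exact Finset.mem_union_left _ (Finset.mem_union_right _
          (Finset.mem_biUnion.2 ⟨b, Finset.mem_univ _, Finset.mem_image_of_mem _ hQ⟩))
      · exact Finset.mem_union_right _ (Finset.mem_singleton_self _)
    · rintro ⟨h1, h2, h3⟩ k hk
      rcases Finset.mem_union.1 hk with hk | hk
      · rcases Finset.mem_union.1 hk with hk | hk
        · obtain ⟨P, hP, rfl⟩ := Finset.mem_image.1 hk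
          exact h1 P hP
        · obtain ⟨b, -, hk⟩ := Finset.mem_biUnion.1 hk
          obtain ⟨P, hP, rfl⟩ := Finset.mem_image.1 hk
          exact h2 b P hP
      · rw [Finset.mem_singleton.1 hk]
        exact h3
  obtain ⟨l, hl, hmain⟩ := farkas_nonneg K f id g (by
    intro z hz hf
    obtain ⟨h1, h2, h3⟩ := (hK z).1 hz
    rw [hg, sub_nonpos, hv]
    refine raw_scaled tl hd s t hst u z.1 z.2.1 z.2.2 h3 h1 h2 ?_ ?_ ?_
    · intro a
      have := hf (Sum.inl a)
      simp only [f, Sum.elim_inl, LinearMap.sub_apply, LinearMap.smul_apply, hXA, hT,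
        smul_eq_mul] at this
      linarith
    · intro b a hab
      have := hf (Sum.inr (Sum.inl (b, a)))
      simp only [f, Sum.elim_inl, Sum.elim_inr, if_neg hab.symm, LinearMap.sub_apply,
        LinearMap.add_apply, LinearMap.smul_apply, hXA, hYA, hT, smul_eq_mul] at this
      linarith
    · intro b
      have := hf (Sum.inr (Sum.inr b))
      simp only [f, Sum.elim_inr, LinearMap.sub_apply, LinearMap.sum_apply, hXA, hY] at this
      linarith)
  let w : A → A → ℝ := fun b a => if b = a then 0 else l (Sum.inr (Sum.inl (b, a)))
  have hsum : ∀ z, (∀ P ∈ PS tl hd s t, 0 ≤ z.1 P) → (∀ b, ∀ Q ∈ QS tl hd t b, 0 ≤ z.2.1 b Q) →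
      0 ≤ z.2.2 → ∑ P ∈ PS tl hd s t, z.1 P - v * z.2.2 ≤
        ∑ a, l (Sum.inl a) * (XA a z - u a * z.2.2)
        + (∑ b, ∑ a, w b a * (YA b a z + XA a z - u a * z.2.2)
        + ∑ b, l (Sum.inr (Sum.inr b)) * (XA b z - ∑ Q ∈ QS tl hd t b, z.2.1 b Q)) := by
    intro z h1 h2 h3
    have := hmain z ((hK z).2 ⟨h1, h2, h3⟩)
    rw [hg, Fintype.sum_sum_type, Fintype.sum_sum_type, Fintype.sum_prod_type] at this
    refine this.trans (le_of_eq ?_)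
    congr 1
    congr 1
    · refine Finset.sum_congr rfl fun b _ => Finset.sum_congr rfl fun a _ => ?_
      dsimp only [w]
      by_cases hab : b = a
      · simp [f, hab]
      · simp only [f, Sum.elim_inl, Sum.elim_inr, if_neg hab, LinearMap.sub_apply,
          LinearMap.add_apply, LinearMap.smul_apply, hT, smul_eq_mul]
    · refine Finset.sum_congr rfl fun b _ => ?_
      simp only [f, Sum.elim_inr, LinearMap.sub_apply, LinearMap.sum_apply, hY]
  have hlist : ∀ (P : List A) (h : A → ℝ), P.Nodup →
      (P.map h).sum = ∑ a, if a ∈ P then h a else 0 := by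
    intro P h hP
    rw [← List.sum_toFinset h hP, ← Finset.sum_filter]
    congr 1
    ext a
    simp
  refine ⟨fun a => l (Sum.inl a), fun b => l (Sum.inr (Sum.inr b)), w, fun a => hl _,
    fun a => hl _, ?_, ?_, ?_, ?_, ?_⟩
  · intro b a
    dsimp only [w]
    split_ifs
    · exact le_rfl
    · exact hl _
  · intro b
    simp [w]
  · intro P hP
    have hPm := (mem_PS _ _ _ _ _).2 hP
    have h := hsum (Pi.single P 1, 0, 0) (fun P' _ => by
      by_cases h : P' = P
      · subst h; simp
      · simp [h]) (by simp) le_rfl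
    have hx : ∀ a, XA a (Pi.single P 1, 0, 0) = if a ∈ P then 1 else 0 := by
      intro a
      rw [hXA]
      simp [Finset.sum_pi_single', hPm]
    have hyy : ∀ b a, YA b a (Pi.single P 1, 0, 0) = 0 := by
      intro b a
      rw [hYA]
      simp
    simp only [hx, hyy] at h
    simp [Finset.sum_pi_single', hPm] at h
    rw [hlist P _ hP.nodup]
    refine h.trans (le_of_eq ?_)
    rw [Finset.sum_comm, ← Finset.sum_add_distrib, ← Finset.sum_add_distrib]
    refine Finset.sum_congr rfl fun a _ => ?_
    split_ifs
    · ring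
    · simp
  · intro b Q hQ hbQ
    have hQm := (mem_QS _ _ _ _ _).2 ⟨hQ, hbQ⟩
    have h := hsum (0, Pi.single b (Pi.single Q 1), 0) (by simp) (fun b' P' _ => by
      by_cases h : b' = b
      · subst h
        by_cases h : P' = Q
        · subst h; simp
        · simp [h]
      · simp [h]) le_rfl
    have hx : ∀ a, XA a (0, Pi.single b (Pi.single Q 1), 0) = 0 := by
      intro a
      rw [hXA]
      simp
    have hyy : ∀ b' a, YA b' a (0, Pi.single b (Pi.single Q 1), 0) =
        if b' = b then (if a ∈ Q then 1 else 0) else 0 := by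
      intro b' a
      rw [hYA]
      by_cases h : b' = b
      · subst h
        simp [Finset.sum_pi_single', hQm]
      · simp [h]
    have hz : ∀ b', ∑ Q' ∈ QS tl hd t b', (Pi.single b (Pi.single Q 1) : A → List A → ℝ) b' Q' =
        if b' = b then 1 else 0 := by
      intro b'
      by_cases h : b' = b
      · subst h
        simp [Finset.sum_pi_single', hQm]
      · simp [h]
    simp only [hx, hyy, hz] at h
    rw [hlist Q _ hQ.nodup]
    have e1 : ∑ b', ∑ a, w b' a * ((if b' = b then (if a ∈ Q then (1:ℝ) else 0) else 0) + 0 - u a * 0)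
        = ∑ a, if a ∈ Q then w b a else 0 := by
      rw [Finset.sum_eq_single b]
      · simp
      · intro b' _ hb
        simp [hb]
      · simp
    rw [e1] at h
    simp at h
    linarith
  · have h := hsum (0, 0, 1) (by simp) (by simp) zero_le_one
    have hx : ∀ a, XA a (0, 0, 1) = 0 := by
      intro a
      rw [hXA]
      simp
    have hyy : ∀ b a, YA b a (0, 0, 1) = 0 := by
      intro b a
      rw [hYA]
      simp
    simp only [hx, hyy] at h
    simp at h
    simp only [mul_comm (u _)]
    linarith

theorem minCutCap_nonneg (tl hd : A → V) (v w : V) (u : A → ℝ) (hu : ∀ a, 0 ≤ u a)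
    (Del : Finset A) : 0 ≤ minCutCap tl hd v w u Del := by
  refine Real.sInf_nonneg ?_
  rintro r ⟨S, -, rfl⟩
  exact Finset.sum_nonneg fun a _ => hu a

theorem rcut_le [DecidableEq A] (tl hd : A → V) (s t : V) (u : A → ℝ) (hu : ∀ a, 0 ≤ u a)
    (R : Finset A) (C : A → Finset A) (h : IsRCut tl hd t R C) :
    sInf {r : ℝ | ∃ (R : Finset A) (C : A → Finset A),
      IsRCut tl hd t R C ∧ r = rcutCap tl hd s t u R C} ≤ rcutCap tl hd s t u R C := by
  refine csInf_le ⟨0, ?_⟩ ⟨R, C, h, rfl⟩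
  rintro r ⟨R, C, -, rfl⟩
  exact add_nonneg (minCutCap_nonneg _ _ _ _ u hu _)
    (Finset.sum_nonneg fun a _ => Finset.sum_nonneg fun a _ => hu a)

theorem rounding [Fintype A] [DecidableEq A] (tl hd : A → V) (s t : V) (hst : s ≠ t)
    (u : A → ℝ) (hu : ∀ a, 0 ≤ u a) (v : ℝ) (hv : v = sSup {r : ℝ | ∃ x : List A → ℝ,
      IsFlow tl hd s t u x ∧ StrictlyReroutable tl hd s t u x ∧ r = flowVal tl hd s t x}) :
    ∃ R C, IsRCut tl hd t R C ∧ rcutCap tl hd s t u R C ≤ 2 * v := by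
  classical
  obtain ⟨y, p, w, hy, hp, hw, hwb, hP, hQ, hcost⟩ := lp_dual tl hd s t hst u v hv
  let y' : A → ℝ := fun a => y a + ∑ b, w b a
  have hy' : ∀ a, 0 ≤ y' a := fun a => add_nonneg (hy a) (Finset.sum_nonneg fun b _ => hw b a)
  obtain ⟨d, hds, hdt, hde⟩ := exists_potential tl hd s t (fun _ => True)
    (fun a => y' a + p a) (fun a => add_nonneg (hy' a) (hp a)) 1 zero_le_one
    (fun Q hQ _ => hP Q hQ)
  have hpot : ∀ b, ∃ d : V → ℝ, d (tl b) ≤ 0 ∧ p b ≤ d t ∧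
      ∀ e, e ≠ b → d (hd e) ≤ d (tl e) + w b e := fun b =>
    exists_potential tl hd (tl b) t (fun a => a ≠ b) (w b) (hw b) (p b) (hp b)
      (fun Q h1 h2 => hQ b Q h1 fun h => h2 b h rfl)
  choose D hD0 hDt hDe using hpot
  obtain ⟨θ, hθ0, hθ1, hθ⟩ := exists_threshold (ι := A ⊕ A × A)
    (Sum.elim u (fun q => u q.2))
    (Sum.elim (fun a => d (tl a) + p a) (fun q => d (tl q.1) + D q.1 (tl q.2)))
    (Sum.elim y' (fun q => w q.1 q.2))
    (by rintro (a | q) <;> simp [hu]) (by rintro (a | q) <;> simp [hy', hw])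
  rw [Fintype.sum_sum_type, Fintype.sum_sum_type, Fintype.sum_prod_type,
    Fintype.sum_prod_type] at hθ
  simp only [Sum.elim_inl, Sum.elim_inr] at hθ
  let R : Finset A := Finset.univ.filter fun e => d (tl e) ≤ θ ∧ θ < d (tl e) + p e
  let S : Finset A := Finset.univ.filter fun e => θ ∈ Set.Ico (d (tl e) + p e) (d (tl e) + p e + y' e)
  let B : A → Finset A := fun e => Finset.univ.filter fun a =>
    θ ∈ Set.Ico (d (tl e) + D e (tl a)) (d (tl e) + D e (tl a) + w e a)
  let C : A → Finset A := fun e => insert e (B e)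
  have hS : ∑ a ∈ S, u a = ∑ a, u a * (Set.Ico (d (tl a) + p a) (d (tl a) + p a + y' a)).indicator
      (fun _ => (1:ℝ)) θ := by
    rw [Finset.sum_filter]
    refine Finset.sum_congr rfl fun a _ => ?_
    rw [Set.indicator_apply]
    split_ifs <;> simp
  have hB : ∀ e, ∑ a ∈ B e, u a = ∑ a, u a * (Set.Ico (d (tl e) + D e (tl a))
      (d (tl e) + D e (tl a) + w e a)).indicator (fun _ => (1:ℝ)) θ := by
    intro e
    rw [Finset.sum_filter]
    refine Finset.sum_congr rfl fun a _ => ?_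
    rw [Set.indicator_apply]
    split_ifs <;> simp
  simp only [← hS, ← hB] at hθ
  refine ⟨R, C, ?_, ?_⟩
  · intro b hb
    refine ⟨Finset.mem_insert_self _ _, fun L hL => ?_⟩
    obtain ⟨-, hb1, hb2⟩ := Finset.mem_filter.1 hb
    by_cases hbL : b ∈ L
    · exact ⟨b, Finset.mem_insert_self _ _, hbL⟩
    · obtain ⟨e, he, h1, h2⟩ := exists_crossing tl hd t (D b) (θ - d (tl b))
        (by have := hDt b; linarith) L (tl b) hL.1 (by have := hD0 b; linarith)
      have h3 := hDe b e (by rintro rfl; exact hbL he)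
      refine ⟨e, Finset.mem_insert_of_mem (Finset.mem_filter.2 ⟨Finset.mem_univ _, ?_, ?_⟩), he⟩
      · linarith
      · linarith
  · have h1 : minCutCap tl hd s t u (R.biUnion C) ≤ ∑ a ∈ S, u a := by
      have h2 : ∑ a ∈ S \ R.biUnion C, u a ≤ ∑ a ∈ S, u a :=
        Finset.sum_le_sum_of_subset_of_nonneg Finset.sdiff_subset fun a _ _ => hu a
      refine le_trans (csInf_le ⟨0, ?_⟩ ⟨S \ R.biUnion C, ⟨Finset.sdiff_disjoint, ?_⟩, rfl⟩) h2
      · rintro r ⟨S, -, rfl⟩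
        exact Finset.sum_nonneg fun a _ => hu a
      · intro L hL hdel
        obtain ⟨e, he, h3, h4⟩ := exists_crossing tl hd t d θ (by linarith) L s hL.1 (by linarith)
        have h5 := hde e trivial
        have heR : e ∉ R := fun h => hdel e he
          (Finset.mem_biUnion.2 ⟨e, h, Finset.mem_insert_self _ _⟩)
        have h6 : d (tl e) + p e ≤ θ := by
          by_contra h
          exact heR (Finset.mem_filter.2 ⟨Finset.mem_univ _, h3, not_le.1 h⟩)
        refine ⟨e, Finset.mem_sdiff.2 ⟨Finset.mem_filter.2 ⟨Finset.mem_univ _, h6, ?_⟩,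
          hdel e he⟩, he⟩
        linarith
    have h2 : ∑ e ∈ R, ∑ a ∈ (C e).erase e, u a ≤ ∑ e, ∑ a ∈ B e, u a := by
      refine (Finset.sum_le_sum fun e _ => ?_).trans
        (Finset.sum_le_sum_of_subset_of_nonneg (Finset.subset_univ R)
          fun e _ _ => Finset.sum_nonneg fun a _ => hu a)
      refine Finset.sum_le_sum_of_subset_of_nonneg ?_ fun a _ _ => hu a
      exact Finset.erase_insert_subset _ _
    have h3 : ∑ a, u a * y' a = ∑ a, u a * y a + ∑ b, ∑ a, u a * w b a := by
      simp only [y', mul_add, Finset.sum_add_distrib, Finset.mul_sum]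
      rw [Finset.sum_comm (s := Finset.univ) (f := fun b a => u a * w b a)]
    have h4 : 0 ≤ ∑ a, u a * y a := Finset.sum_nonneg fun a _ => mul_nonneg (hu a) (hy a)
    rw [rcutCap]
    linarith

/-- With `vRF`, `vSRF` the optimal (supremum) values of reroutable and
strictly reroutable flows and `c` the minimum (infimum) R-cut capacity: if `vSRF > 0`
then `min (c / vRF) (vRF / vSRF) ≤ √2`; equivalently `c ≤ 2 · vSRF`, so the flow/cut gap
and the gap between reroutable and strictly reroutable flows cannot both exceed `√2`. -/
theorem gaps_cannot_both_exceed_sqrt_two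
    {V A : Type} [Fintype V] [DecidableEq V] [Fintype A] [DecidableEq A]
    (tl hd : A → V) (s t : V) (u : A → ℝ) (hu : ∀ a, 0 ≤ u a)
    (hcover : ∀ v : V, ∃ L : List A, IsPath tl hd s t L ∧ v ∈ s :: L.map hd)
    (vRF vSRF c : ℝ)
    (hvRF : vRF = sSup {r : ℝ | ∃ x : List A → ℝ,
      IsFlow tl hd s t u x ∧ Reroutable tl hd s t u x ∧ r = flowVal tl hd s t x})
    (hvSRF : vSRF = sSup {r : ℝ | ∃ x : List A → ℝ,
      IsFlow tl hd s t u x ∧ StrictlyReroutable tl hd s t u x ∧ r = flowVal tl hd s t x})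
    (hc : c = sInf {r : ℝ | ∃ (R : Finset A) (C : A → Finset A),
      IsRCut tl hd t R C ∧ r = rcutCap tl hd s t u R C}) :
    c ≤ 2 * vSRF ∧ (0 < vSRF → min (c / vRF) (vRF / vSRF) ≤ Real.sqrt 2) := by
  have hmain : c ≤ 2 * vSRF := by
    by_cases hst : s = t
    · have h1 : 0 ≤ vSRF := by
        rw [hvSRF]
        refine Real.sSup_nonneg ?_
        rintro r ⟨x, hx, -, rfl⟩
        exact finsum_nonneg fun P => finsum_nonneg fun _ => hx.1 P
      have h2 := rcut_le tl hd s t u hu ∅ (fun _ => ∅) (by intro a ha; simp at ha)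
      have h3 : rcutCap tl hd s t u ∅ (fun _ => ∅) = 0 := by
        have : {c : ℝ | ∃ S : Finset A, IsCutIn tl hd s t ∅ S ∧ c = ∑ a ∈ S, u a} = ∅ := by
          ext r
          simp only [Set.mem_setOf_eq, Set.mem_empty_iff_false, iff_false]
          rintro ⟨S, hS, -⟩
          obtain ⟨a, -, ha⟩ := hS.2 [] ⟨hst, by simp⟩ (by simp)
          simp at ha
        simp [rcutCap, minCutCap, this]
      rw [hc]
      linarith
    · obtain ⟨R, C, hRC, hle⟩ := rounding tl hd s t hst u hu vSRF hvSRF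
      rw [hc]
      exact (rcut_le tl hd s t u hu R C hRC).trans hle
  refine ⟨hmain, fun hpos => ?_⟩
  by_contra hcon
  rw [not_le, lt_min_iff] at hcon
  obtain ⟨h1, h2⟩ := hcon
  have hs : 0 < Real.sqrt 2 := by positivity
  have hss : Real.sqrt 2 * Real.sqrt 2 = 2 := Real.mul_self_sqrt (by norm_num)
  rw [lt_div_iff₀ hpos] at h2
  have hR : 0 < vRF := lt_trans (by positivity) h2
  rw [lt_div_iff₀ hR] at h1
  have h3 := mul_lt_mul_of_pos_left h2 hs
  rw [← mul_assoc, hss] at h3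
  linarith
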